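/- In the general hierarchical Poisson model, let a^J = (a^J_0,…,a^J_D) be the Jeffreys exponent vector a^J_d = (1/2)·Π_{d'=d+1}^D n_{d'} (empty product = 1). Suppose n_D ≥ 2. Then for every D' ∈ {1,…,D} and every parameter λ (all entries positive), R̃(λ̂^{(a^J)}(X(D'−1)), λ) < R̃(λ̂^{(a^J)}(X(D')), λ); in particular, the Bayes estimator based on only the bottom-level data X(D) is strictly dominated by the Bayes estimator based on all the data X = X(0). -/

import Mathlib

open scoped BigOperators ENNReal

/-- The Poisson(μ) probability of the value `k`. -/
noncomputable def poissonPmf (mu : ℝ) (k : ℕ) : ℝ :=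
  mu ^ k * Real.exp (-mu) / (Nat.factorial k)

/-- The index set I_d = Π_{d'=1}^d {1,…,n_{d'}} of level d of the hierarchy. -/
abbrev Idx (n : ℕ → ℕ) (d : ℕ) := (k : Fin d) → Fin (n (k.val + 1))

/-- Restriction of a level-e index to its first d coordinates. -/
def resIdx (n : ℕ → ℕ) {d e : ℕ} (h : d ≤ e) (j : Idx n e) : Idx n d :=
  fun k => j (Fin.castLE h k)

/-- Marginal sum v_{(i_1,…,i_d)} = Σ over extensions j ∈ I_D of i of v_j. -/
noncomputable def marg (n : ℕ → ℕ) (D : ℕ) (v : Idx n D → ℝ) {d : ℕ} (h : d ≤ D)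
    (i : Idx n d) : ℝ :=
  ∑ j : Idx n D, if resIdx n h j = i then v j else 0

/-- The sample space: one observation X_{(i_1,…,i_d)} ∈ ℕ for each level d = 0,…,D
and each index in I_d. -/
abbrev Obs (n : ℕ → ℕ) (D : ℕ) := (d : Fin (D + 1)) → Idx n d.val → ℕ

/-- Joint pmf of the hierarchical observations: all X_{(i_1,…,i_d)} independent,
X_{(i_1,…,i_d)} ~ Po(λ_{(i_1,…,i_d)}). -/
noncomputable def hierPmf (n : ℕ → ℕ) (D : ℕ) (lam : Idx n D → ℝ) (X : Obs n D) : ℝ :=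
  ∏ d : Fin (D + 1), ∏ i : Idx n d.val,
    poissonPmf (marg n D lam (Nat.lt_succ_iff.mp d.isLt) i) (X d i)

/-- X̃_{(i_1,…,i_d,+)}(D') = Σ_{d'=d}^D Σ_{extensions j ∈ I_{d'} of i} X̃_{(j)}(D'),
where X̃_{(j)}(D') = X_{(j)} if the level of j is ≥ D' and 0 otherwise. -/
def plusSum (n : ℕ → ℕ) (D : ℕ) (X : Obs n D) (D' : ℕ) {d : ℕ} (hd : d ≤ D)
    (i : Idx n d) : ℕ :=
  ∑ d' : Fin (D + 1), if h : d ≤ d'.val then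
    ∑ j : Idx n d'.val, if resIdx n h j = i ∧ D' ≤ d'.val then X d' j else 0
  else 0

/-- The generalized Bayes estimator λ̂^{(a)}(X(D')) under the prior with exponents a,
based on the data at levels D', D'+1, …, D. Its (i_1,…,i_D)-component is
((X̃_{(+)}(D') + a_0)/(1+D−D'))·Π_{d=1}^D (X̃_{(i_1,…,i_d,+)}(D') + a_d) /
(Σ_{i_d'} X̃_{(i_1,…,i_{d−1},i_d',+)}(D') + n_d a_d). -/
noncomputable def hierBayes (n : ℕ → ℕ) (D : ℕ) (a : ℕ → ℝ) (D' : ℕ) (X : Obs n D)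
    (j : Idx n D) : ℝ :=
  (((plusSum n D X D' (Nat.zero_le D) (fun k => k.elim0) : ℕ) : ℝ) + a 0) /
      (1 + (D : ℝ) - (D' : ℝ)) *
    ∏ d : Fin D,
      (((plusSum n D X D' d.isLt (resIdx n d.isLt j) : ℕ) : ℝ) + a (d.val + 1)) /
        ((∑ i2 : Idx n (d.val + 1),
            if resIdx n (Nat.le_succ d.val) i2 = resIdx n (le_of_lt d.isLt) j
            then ((plusSum n D X D' d.isLt i2 : ℕ) : ℝ) else 0) +
          (n (d.val + 1) : ℝ) * a (d.val + 1))

/-- Entropy loss L̃^KL(δ, λ) = Σ_{d=0}^D Σ_{i ∈ I_d}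
λ_{(i)}·(δ_{(i)}/λ_{(i)} − 1 − log(δ_{(i)}/λ_{(i)})). -/
noncomputable def hierLoss (n : ℕ → ℕ) (D : ℕ) (δ : Idx n D → ℝ) (lam : Idx n D → ℝ) : ℝ :=
  ∑ d : Fin (D + 1), ∑ i : Idx n d.val,
    marg n D lam (Nat.lt_succ_iff.mp d.isLt) i *
      (marg n D δ (Nat.lt_succ_iff.mp d.isLt) i / marg n D lam (Nat.lt_succ_iff.mp d.isLt) i
        - 1 -
        Real.log (marg n D δ (Nat.lt_succ_iff.mp d.isLt) i /
          marg n D lam (Nat.lt_succ_iff.mp d.isLt) i))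

/-- Entropy risk R̃(δ, λ) of an estimator δ of λ based on X, valued in [0,∞]. -/
noncomputable def hierRisk (n : ℕ → ℕ) (D : ℕ) (δ : Obs n D → Idx n D → ℝ)
    (lam : Idx n D → ℝ) : ℝ≥0∞ :=
  ∑' X : Obs n D, ENNReal.ofReal (hierLoss n D (δ X) lam * hierPmf n D lam X)

open MeasureTheory ProbabilityTheory

section PoissonSeries

variable {f : ℕ → ℝ} {C r : ℝ}

lemma summable_pow_div_factorial_mul (hf : ∀ k, |f k| ≤ C * r ^ k) (x : ℝ) :
    Summable fun k : ℕ => x ^ k / (k.factorial : ℝ) * f k := by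
  have hs := (Real.summable_pow_div_factorial (|x| * r)).mul_left C
  refine Summable.of_norm_bounded hs fun k => ?_
  rw [Real.norm_eq_abs, abs_mul, abs_div, abs_pow, Nat.abs_cast]
  calc |x| ^ k / (k.factorial : ℝ) * |f k| ≤ |x| ^ k / (k.factorial : ℝ) * (C * r ^ k) := by
        gcongr; exact hf k
    _ = C * ((|x| * r) ^ k / (k.factorial : ℝ)) := by rw [mul_pow]; ring

lemma pow_succ_div_factorial_mul (g : ℕ → ℝ) (x : ℝ) (k : ℕ) :
    x ^ (k + 1) / ((k + 1).factorial : ℝ) * (((k + 1 : ℕ) : ℝ) * g k) =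
      x * (x ^ k / (k.factorial : ℝ) * g k) := by
  have h1 : ((k : ℝ) + 1) ≠ 0 := by positivity
  have h2 : (k.factorial : ℝ) ≠ 0 := by positivity
  rw [Nat.factorial_succ]
  push_cast
  field_simp
  ring

/-- The index shift `x · Σ xᵏ/k! g(k) = Σ xᵏ/k! k g(k-1)`. -/
lemma hasSum_pow_div_factorial_shift {g : ℕ → ℝ} {x s : ℝ}
    (h : HasSum (fun k : ℕ => x ^ k / (k.factorial : ℝ) * g k) s) :
    HasSum (fun k : ℕ => x ^ k / (k.factorial : ℝ) * ((k : ℝ) * g (k - 1))) (x * s) := by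
  rw [← hasSum_nat_add_iff' 1]
  simp only [pow_succ_div_factorial_mul, Nat.add_sub_cancel, Finset.sum_range_one, Nat.cast_zero,
    zero_mul, mul_zero, sub_zero]
  exact h.mul_left x

lemma hasSum_pow_div_factorial_mul_one (x : ℝ) :
    HasSum (fun k : ℕ => x ^ k / (k.factorial : ℝ) * 1) (Real.exp x) := by
  have := NormedSpace.expSeries_div_hasSum_exp x
  rw [← Real.exp_eq_exp_ℝ] at this
  simpa using this

lemma hasDerivAt_tsum_pow_div_factorial_mul (hf : ∀ k, |f k| ≤ C * r ^ k) (x : ℝ) :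
    HasDerivAt (fun y : ℝ => ∑' k : ℕ, y ^ k / (k.factorial : ℝ) * f k)
      (∑' k : ℕ, x ^ k / (k.factorial : ℝ) * f (k + 1)) x := by
  have hf1 : ∀ k, |f (k + 1)| ≤ (C * r) * r ^ k := fun k => by
    rw [mul_assoc, ← pow_succ']; exact hf (k + 1)
  set R : ℝ := |x| + 1
  have hterm : ∀ (y : ℝ) (k : ℕ), (k + 1 : ℕ) * y ^ k / ((k + 1).factorial : ℝ) * f (k + 1)
      = y ^ k / (k.factorial : ℝ) * f (k + 1) := fun y k => by
    have h1 : ((k : ℝ) + 1) ≠ 0 := by positivity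
    rw [Nat.factorial_succ]; push_cast; field_simp
  have hbound : Summable fun k : ℕ => (k : ℝ) * R ^ (k - 1) / (k.factorial : ℝ) * |f k| := by
    rw [← summable_nat_add_iff 1]
    refine (summable_pow_div_factorial_mul (f := fun k => |f (k + 1)|) (C := C * r) (r := r)
      (fun k => by rw [abs_abs]; exact hf1 k) R).congr fun k => ?_
    have h1 : ((k : ℝ) + 1) ≠ 0 := by positivity
    rw [Nat.factorial_succ, Nat.add_sub_cancel]; push_cast; field_simp
  have hmem : x ∈ Set.Ioo (-R) R := by
    rw [Set.mem_Ioo, ← abs_lt]; linarith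
  have key := hasDerivAt_tsum_of_isPreconnected (t := Set.Ioo (-R) R)
    (g := fun (k : ℕ) (y : ℝ) => y ^ k / (k.factorial : ℝ) * f k)
    (g' := fun (k : ℕ) (y : ℝ) => (k : ℝ) * y ^ (k - 1) / (k.factorial : ℝ) * f k)
    hbound isOpen_Ioo isPreconnected_Ioo
    (fun k y _ => ((hasDerivAt_pow k y).div_const _).mul_const _)
    (fun k y hy => by
      have hy' : |y| ≤ R := (abs_lt.mpr hy).le
      rw [Real.norm_eq_abs, abs_mul, abs_div, abs_mul, abs_pow, Nat.abs_cast, Nat.abs_cast]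
      gcongr)
    hmem (summable_pow_div_factorial_mul hf x) hmem
  refine key.congr_deriv ?_
  have hs : Summable fun k : ℕ => (k : ℝ) * x ^ (k - 1) / (k.factorial : ℝ) * f k := by
    rw [← summable_nat_add_iff 1]
    exact (summable_pow_div_factorial_mul hf1 x).congr fun k => by
      rw [← hterm x k, Nat.add_sub_cancel]
  rw [hs.tsum_eq_zero_add]
  simp only [Nat.cast_zero, zero_mul, zero_div, zero_add, Nat.add_sub_cancel]
  exact tsum_congr fun k => hterm x k

end PoissonSeries

section PoissonRisk

lemma abs_log_le_add_inv {x : ℝ} (hx : 0 < x) : |Real.log x| ≤ x + x⁻¹ := by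
  have h1 := Real.log_le_sub_one_of_pos hx
  have h2 := Real.one_sub_inv_le_log_of_pos hx
  have h3 := inv_pos.mpr hx
  rw [abs_le]; constructor <;> linarith

lemma abs_log_natCast_add_le {a : ℝ} (ha : 0 < a) (k : ℕ) :
    |Real.log (k + a)| ≤ (1 + a + a⁻¹) * 2 ^ k := by
  have hk : (k : ℝ) + 1 ≤ 2 ^ k := by exact_mod_cast Nat.lt_two_pow_self
  have hka : 0 < (k : ℝ) + a := by positivity
  have h1 : ((k : ℝ) + a)⁻¹ ≤ a⁻¹ := by gcongr; linarith [Nat.cast_nonneg (α := ℝ) k]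
  have h2 := abs_log_le_add_inv hka
  have h3 := inv_pos.mpr ha
  have h4 : (1 : ℝ) ≤ 2 ^ k := one_le_pow₀ (by norm_num)
  nlinarith

/-- The expectation of `f` under the Poisson distribution with mean `x`. -/
noncomputable def poissonExp (f : ℕ → ℝ) (x : ℝ) : ℝ :=
  Real.exp (-x) * ∑' k : ℕ, x ^ k / (k.factorial : ℝ) * f k

lemma tsum_poisson_log_diff_pos {a x : ℝ} (ha : 1 ≤ a) (hx : 0 < x) :
    0 < x * (x * ∑' k : ℕ, x ^ k / (k.factorial : ℝ) *
      (Real.log ((k + 1 : ℕ) + a) - Real.log (k + a))) - x * Real.exp x + a * Real.exp x := by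
  have ha0 : 0 < a := by linarith
  set h : ℕ → ℝ := fun k => Real.log ((k + 1 : ℕ) + a) - Real.log (k + a)
  have hlow : ∀ k : ℕ, 1 / (k + a + 1 / 2) ≤ h k := by
    intro k
    have hka : 0 < (k : ℝ) + a := by positivity
    have h1 := Real.le_log_one_add_of_nonneg (inv_pos.mpr hka).le
    have h2 : 1 + ((k : ℝ) + a)⁻¹ = (((k + 1 : ℕ) : ℝ) + a) / (k + a) := by
      push_cast; field_simp; ring
    rw [h2, Real.log_div (by positivity) hka.ne'] at h1
    refine le_trans (le_of_eq ?_) h1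
    field_simp
    ring
  have hup : ∀ k : ℕ, |h k| ≤ (3 * (1 + a + a⁻¹)) * 2 ^ k := by
    intro k
    have h1 := abs_log_natCast_add_le ha0 (k + 1)
    have h2 := abs_log_natCast_add_le ha0 k
    rw [pow_succ] at h1
    calc |h k| ≤ _ := abs_sub _ _
      _ ≤ _ := by linarith
  have s0 := (summable_pow_div_factorial_mul hup x).hasSum
  have s1 := hasSum_pow_div_factorial_shift (hasSum_pow_div_factorial_shift s0)
  have e0 := hasSum_pow_div_factorial_mul_one x
  have e1 := hasSum_pow_div_factorial_shift (g := fun _ => 1) e0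
  have tot := (s1.sub e1).add (e0.mul_left a)
  have hpt : ∀ k : ℕ, 0 ≤ (k : ℝ) * (((k - 1 : ℕ) : ℝ) * h (k - 1 - 1)) - k + a := by
    intro k
    match k with
    | 0 => simp; linarith
    | 1 => simp; linarith
    | m + 2 =>
      have hd : 0 < (m : ℝ) + a + 1 / 2 := by positivity
      have hm : (0 : ℝ) ≤ m := Nat.cast_nonneg m
      have h1 := hlow m
      have e : (m + 2 - 1 - 1) = m := by omega
      have e' : (m + 2 - 1) = m + 1 := by omega
      rw [e, e']
      push_cast
      have h2 : ((m : ℝ) + 2) * ((m + 1) * (1 / (m + a + 1 / 2))) ≤ (m + 2) * ((m + 1) * h m) := by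
        gcongr
      have h3 : (m : ℝ) + 2 - a ≤ ((m : ℝ) + 2) * ((m + 1) * (1 / (m + a + 1 / 2))) := by
        rw [mul_one_div, ← mul_div_assoc, le_div_iff₀ hd]
        nlinarith
      linarith
  have hterm : ∀ k : ℕ, x ^ k / (k.factorial : ℝ) * ((k : ℝ) * (((k - 1 : ℕ) : ℝ) * h (k - 1 - 1)))
      - x ^ k / (k.factorial : ℝ) * ((k : ℝ) * 1) + a * (x ^ k / (k.factorial : ℝ) * 1) =
      x ^ k / (k.factorial : ℝ) * ((k : ℝ) * (((k - 1 : ℕ) : ℝ) * h (k - 1 - 1)) - k + a) :=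
    fun k => by ring
  change 0 < x * (x * ∑' k : ℕ, x ^ k / (k.factorial : ℝ) * h k) - x * Real.exp x + a * Real.exp x
  rw [← tot.tsum_eq]
  refine tot.summable.tsum_pos (fun k => ?_) 0 ?_
  · rw [hterm]
    exact mul_nonneg (by positivity) (hpt k)
  · simp; linarith

lemma hasDerivAt_poissonExp_log {a : ℝ} (ha : 0 < a) (x : ℝ) :
    HasDerivAt (poissonExp fun k => Real.log (k + a))
      (Real.exp (-x) * ∑' k : ℕ, x ^ k / (k.factorial : ℝ) *
        (Real.log ((k + 1 : ℕ) + a) - Real.log (k + a))) x := by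
  have hb := abs_log_natCast_add_le ha
  have hd := hasDerivAt_tsum_pow_div_factorial_mul hb x
  have he : HasDerivAt (fun y : ℝ => Real.exp (-y)) (-Real.exp (-x)) x := by
    simpa using (hasDerivAt_neg x).exp
  have s0 := summable_pow_div_factorial_mul hb x
  have s1 := summable_pow_div_factorial_mul (f := fun k : ℕ => Real.log ((k + 1 : ℕ) + a))
    (C := (1 + a + a⁻¹) * 2) (r := 2)
    (fun k => by rw [mul_assoc, ← pow_succ']; exact hb (k + 1)) x
  refine (he.mul hd).congr_deriv ?_
  simp_rw [mul_sub]
  rw [s1.tsum_sub s0]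
  ring

/-- The expected value of `δ - λ log δ` for `δ = (S + a) / t` with `S` Poisson of mean `t λ`
(up to the additive constant `λ`). -/
noncomputable def gammaBayesRisk (lam a t : ℝ) : ℝ :=
  a / t - lam * (poissonExp (fun k => Real.log (k + a)) (t * lam) - Real.log t)

lemma gammaBayesRisk_strictAntiOn {lam a : ℝ} (hl : 0 < lam) (ha : 1 ≤ a) :
    StrictAntiOn (gammaBayesRisk lam a) (Set.Ioi 0) := by
  have ha0 : 0 < a := by linarith
  have hder : ∀ t : ℝ, 0 < t → HasDerivAt (gammaBayesRisk lam a)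
      (-a / t ^ 2 - lam * ((Real.exp (-(t * lam)) * ∑' k : ℕ, (t * lam) ^ k / (k.factorial : ℝ) *
        (Real.log ((k + 1 : ℕ) + a) - Real.log (k + a))) * lam - t⁻¹)) t := by
    intro t ht
    have h1 : HasDerivAt (fun t : ℝ => a / t) (-a / t ^ 2) t := by
      simpa [div_eq_mul_inv, neg_mul] using (hasDerivAt_inv ht.ne').const_mul a
    have h2 : HasDerivAt (fun t : ℝ => t * lam) lam t := by
      simpa using (hasDerivAt_id t).mul_const lam
    have h3 := (hasDerivAt_poissonExp_log ha0 (t * lam)).comp t h2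
    exact h1.sub ((h3.sub (Real.hasDerivAt_log ht.ne')).const_mul lam)
  refine strictAntiOn_of_deriv_neg (convex_Ioi 0)
    (fun t ht => (hder t ht).continuousAt.continuousWithinAt) fun t ht => ?_
  rw [interior_Ioi] at ht
  have ht : 0 < t := ht
  rw [(hder t ht).deriv]
  have key := tsum_poisson_log_diff_pos ha (mul_pos ht hl)
  set T := ∑' k : ℕ, (t * lam) ^ k / (k.factorial : ℝ) *
        (Real.log ((k + 1 : ℕ) + a) - Real.log (k + a))
  have hexp : Real.exp (-(t * lam)) * Real.exp (t * lam) = 1 := by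
    rw [← Real.exp_add]; simp
  have key2 := mul_pos (Real.exp_pos (-(t * lam))) key
  have e : -a / t ^ 2 - lam * ((Real.exp (-(t * lam)) * T) * lam - t⁻¹) =
      -(1 / t ^ 2 * (Real.exp (-(t * lam)) * (t * lam * (t * lam * T)
        - t * lam * Real.exp (t * lam) + a * Real.exp (t * lam)))) := by
    have e2 : Real.exp (-(t * lam)) * (t * lam * (t * lam * T)
        - t * lam * Real.exp (t * lam) + a * Real.exp (t * lam)) =
        Real.exp (-(t * lam)) * (t * lam * (t * lam * T)) - t * lam + a := by
      linear_combination (a - t * lam) * hexp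
    rw [e2]
    field_simp
    ring
  rw [e]
  have : 0 < 1 / t ^ 2 := by positivity
  linarith [mul_pos this key2]

end PoissonRisk

section PoissonIntegral

open scoped NNReal

lemma integrable_poissonMeasure_of_le {f : ℕ → ℝ} {C r : ℝ} (hf : ∀ k, |f k| ≤ C * r ^ k)
    (x : ℝ≥0) : Integrable f (poissonMeasure x) := by
  rw [integrable_poissonMeasure_iff]
  have h := summable_pow_div_factorial_mul (f := fun k => |f k|) (C := C) (r := r)
    (fun k => by rw [abs_abs]; exact hf k) x
  refine (h.mul_left (Real.exp (-x))).congr fun k => ?_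
  rw [Real.norm_eq_abs]
  ring

lemma integral_poissonMeasure_eq_poissonExp (f : ℕ → ℝ) (x : ℝ≥0) :
    ∫ k, f k ∂(poissonMeasure x) = poissonExp f x := by
  rw [integral_poissonMeasure, poissonExp, ← tsum_mul_left]
  refine tsum_congr fun k => ?_
  rw [smul_eq_mul]
  ring

lemma poissonExp_natCast (x : ℝ) : poissonExp (fun k => (k : ℝ)) x = x := by
  have h := (hasSum_pow_div_factorial_shift (hasSum_pow_div_factorial_mul_one x)).tsum_eq
  simp only [mul_one] at h
  rw [poissonExp, h, mul_left_comm, ← Real.exp_add]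
  simp

lemma integrable_natCast_poissonMeasure (x : ℝ≥0) :
    Integrable (fun k : ℕ => (k : ℝ)) (poissonMeasure x) := by
  refine integrable_poissonMeasure_of_le (C := 1) (r := 2) (fun k => ?_) x
  rw [Nat.abs_cast, one_mul]
  exact_mod_cast Nat.lt_two_pow_self.le

/-- The entropy loss of the estimate `x` of a single positive mean `l`. -/
noncomputable def entropyLoss (l x : ℝ) : ℝ := l * (x / l - 1 - Real.log (x / l))

lemma entropyLoss_nonneg {l x : ℝ} (hl : 0 < l) (hx : 0 < x) : 0 ≤ entropyLoss l x :=
  mul_nonneg hl.le (by linarith [Real.log_le_sub_one_of_pos (div_pos hx hl)])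

lemma entropyLoss_eq {l x : ℝ} (hl : 0 < l) (hx : 0 < x) :
    entropyLoss l x = x - l - l * (Real.log x - Real.log l) := by
  rw [entropyLoss, Real.log_div hx.ne' hl.ne']
  field_simp

lemma entropyLoss_natCast_add_div {l a t : ℝ} (hl : 0 < l) (ha : 0 < a) (ht : 0 < t) (k : ℕ) :
    entropyLoss l ((k + a) / t) =
      (k : ℝ) * t⁻¹ - l * Real.log (k + a) + (a / t - l + l * Real.log t + l * Real.log l) := by
  have hk : 0 < (k : ℝ) + a := by positivity
  rw [entropyLoss_eq hl (div_pos hk ht), Real.log_div hk.ne' ht.ne']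
  ring

lemma integrable_entropyLoss_poissonMeasure {l a t : ℝ} (hl : 0 < l) (ha : 0 < a) (ht : 0 < t)
    (x : ℝ≥0) : Integrable (fun k : ℕ => entropyLoss l ((k + a) / t)) (poissonMeasure x) := by
  simp_rw [entropyLoss_natCast_add_div hl ha ht]
  exact (((integrable_natCast_poissonMeasure x).mul_const _).sub
    ((integrable_poissonMeasure_of_le (abs_log_natCast_add_le ha) x).const_mul l)).add
    (integrable_const _)

lemma integral_entropyLoss_poissonMeasure {l a t : ℝ} (hl : 0 < l) (ha : 0 < a) (ht : 0 < t) :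
    ∫ k : ℕ, entropyLoss l ((k + a) / t) ∂(poissonMeasure (t * l).toNNReal) =
      gammaBayesRisk l a t + l * Real.log l := by
  simp_rw [entropyLoss_natCast_add_div hl ha ht]
  have h1 := integrable_natCast_poissonMeasure (t * l).toNNReal
  have h2 := integrable_poissonMeasure_of_le (abs_log_natCast_add_le ha) (t * l).toNNReal
  have htl : ((t * l).toNNReal : ℝ) = t * l := Real.coe_toNNReal _ (by positivity)
  have h3 : Integrable (fun k : ℕ => (k : ℝ) * t⁻¹ - l * Real.log (k + a))
      (poissonMeasure (t * l).toNNReal) := (h1.mul_const _).sub (h2.const_mul l)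
  rw [integral_add h3 (integrable_const _),
    integral_sub (h1.mul_const _) (h2.const_mul l), integral_mul_const, integral_const_mul,
    integral_poissonMeasure_eq_poissonExp, integral_poissonMeasure_eq_poissonExp,
    poissonExp_natCast, htl, gammaBayesRisk]
  simp only [integral_const, probReal_univ, smul_eq_mul, one_mul]
  field_simp
  ring

end PoissonIntegral

section Hierarchy

variable {n : ℕ → ℕ} {D : ℕ}

lemma sum_sum_ite_resIdx {M : Type*} [AddCommMonoid M] {d e : ℕ} (h : d ≤ e) (F : Idx n e → M) :
    ∑ i : Idx n d, ∑ j : Idx n e, (if resIdx n h j = i then F j else 0) = ∑ j : Idx n e, F j := by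
  rw [Finset.sum_comm]
  simp

lemma sum_ite_resIdx_sum_ite_resIdx {M : Type*} [AddCommMonoid M] {d e f : ℕ} (h : d ≤ e)
    (h' : e ≤ f) (F : Idx n f → M) (i : Idx n d) :
    ∑ j : Idx n e, (if resIdx n h j = i then
      ∑ k : Idx n f, (if resIdx n h' k = j then F k else 0) else 0) =
    ∑ k : Idx n f, if resIdx n (h.trans h') k = i then F k else 0 := by
  have hpush : ∀ j : Idx n e, (if resIdx n h j = i then
      ∑ k : Idx n f, (if resIdx n h' k = j then F k else 0) else 0) =
      ∑ k : Idx n f, if resIdx n h' k = j then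
        (if resIdx n (h.trans h') k = i then F k else 0) else 0 := by
    intro j
    rw [← Finset.sum_const_zero (s := (Finset.univ : Finset (Idx n f))),
      ← apply_ite (fun G : Idx n f → M => ∑ k, G k)]
    refine Finset.sum_congr rfl fun k _ => ?_
    by_cases hk : resIdx n h' k = j
    · subst hk
      by_cases hi : resIdx n (h.trans h') k = i
      · have hi' : resIdx n h (resIdx n h' k) = i := hi
        simp [hi, hi']
      · have hi' : ¬ resIdx n h (resIdx n h' k) = i := hi
        simp [hi, hi']
    · simp [hk, ite_apply]
  simp_rw [hpush]
  rw [Finset.sum_comm]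
  simp

lemma marg_eq_sum_marg (v : Idx n D → ℝ) {d e : ℕ} (h : d ≤ e) (he : e ≤ D) (i : Idx n d) :
    marg n D v (h.trans he) i =
      ∑ j : Idx n e, if resIdx n h j = i then marg n D v he j else 0 :=
  (sum_ite_resIdx_sum_ite_resIdx h he v i).symm

lemma marg_self (v : Idx n D → ℝ) (i : Idx n D) : marg n D v le_rfl i = v i := by
  have h : ∀ j : Idx n D, resIdx n le_rfl j = j := fun _ => rfl
  simp [marg, h]

lemma exists_resIdx_eq (hn : ∀ d, 1 ≤ d → d ≤ D → 1 ≤ n d) {d : ℕ} (h : d ≤ D) (i : Idx n d) :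
    ∃ j : Idx n D, resIdx n h j = i :=
  ⟨fun k => if hk : k.val < d then i ⟨k.val, hk⟩ else
      ⟨0, hn _ (Nat.le_add_left _ _) k.isLt⟩, by
    funext k
    simp [resIdx]⟩

lemma marg_pos (hn : ∀ d, 1 ≤ d → d ≤ D → 1 ≤ n d) {v : Idx n D → ℝ} (hv : ∀ j, 0 < v j)
    {d : ℕ} (h : d ≤ D) (i : Idx n d) : 0 < marg n D v h i := by
  obtain ⟨j, hj⟩ := exists_resIdx_eq hn h i
  refine Finset.sum_pos' (fun k _ => ?_) ⟨j, Finset.mem_univ _, ?_⟩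
  · split_ifs
    exacts [(hv k).le, le_rfl]
  · simpa [hj] using hv j

lemma sum_ite_resIdx_const (d : ℕ) (i : Idx n d) (c : ℝ) :
    ∑ j : Idx n (d + 1), (if resIdx n (Nat.le_succ d) j = i then c else 0) = n (d + 1) * c := by
  rw [← (Fin.snocEquiv fun k : Fin (d + 1) => Fin (n (k.val + 1))).sum_comp,
    Fintype.sum_prod_type]
  have h : ∀ (x : Fin (n (d + 1))) (y : Idx n d),
      resIdx n (Nat.le_succ d)
        ((Fin.snocEquiv fun k : Fin (d + 1) => Fin (n (k.val + 1))) (x, y)) = y := by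
    intro x y
    funext k
    exact Fin.snoc_castSucc (α := fun k : Fin (d + 1) => Fin (n (k.val + 1))) x y k
  calc _ = ∑ x : Fin (n (d + 1)), ∑ y : Idx n d, (if y = i then c else 0) :=
        Finset.sum_congr rfl fun x _ => Finset.sum_congr rfl fun y _ =>
          congrArg (fun z => if z = i then c else 0) (h x y)
    _ = _ := by simp

/-- The conditional share that the estimator based on the levels `≥ D'` gives to a child. -/
noncomputable def splitRatio (n : ℕ → ℕ) (D : ℕ) (a : ℕ → ℝ) (D' : ℕ) (X : Obs n D) {d : ℕ}
    (hd : d + 1 ≤ D) (i : Idx n (d + 1)) : ℝ :=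
  (((plusSum n D X D' hd i : ℕ) : ℝ) + a (d + 1)) /
    ((∑ i2 : Idx n (d + 1),
        if resIdx n (Nat.le_succ d) i2 = resIdx n (Nat.le_succ d) i
        then ((plusSum n D X D' hd i2 : ℕ) : ℝ) else 0) +
      (n (d + 1) : ℝ) * a (d + 1))

/-- The marginal of the generalized Bayes estimator at level `e`, in product form. -/
noncomputable def levelBayes (n : ℕ → ℕ) (D : ℕ) (a : ℕ → ℝ) (D' : ℕ) (X : Obs n D) {e : ℕ}
    (he : e ≤ D) (i : Idx n e) : ℝ :=
  (((plusSum n D X D' (Nat.zero_le D) (fun k => k.elim0) : ℕ) : ℝ) + a 0) /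
      (1 + (D : ℝ) - (D' : ℝ)) *
    ∏ d : Fin e, splitRatio n D a D' X (Nat.le_trans d.isLt he) (resIdx n d.isLt i)

lemma hierBayes_eq_levelBayes (a : ℕ → ℝ) (D' : ℕ) (X : Obs n D) :
    hierBayes n D a D' X = levelBayes n D a D' X le_rfl := rfl

lemma levelBayes_succ (a : ℕ → ℝ) (D' : ℕ) (X : Obs n D) {e : ℕ} (he : e + 1 ≤ D)
    (i : Idx n (e + 1)) :
    levelBayes n D a D' X he i =
      levelBayes n D a D' X (Nat.le_of_succ_le he) (resIdx n (Nat.le_succ e) i) *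
        splitRatio n D a D' X he i := by
  rw [levelBayes, Fin.prod_univ_castSucc, ← mul_assoc]
  rfl

variable {a : ℕ → ℝ}

lemma splitRatio_denom_pos (hn : ∀ d, 1 ≤ d → d ≤ D → 1 ≤ n d) (ha : ∀ d, 0 < a d) (D' : ℕ)
    (X : Obs n D) {d : ℕ} (hd : d + 1 ≤ D) (i : Idx n d) :
    0 < (∑ i2 : Idx n (d + 1),
        if resIdx n (Nat.le_succ d) i2 = i
        then ((plusSum n D X D' hd i2 : ℕ) : ℝ) else 0) + (n (d + 1) : ℝ) * a (d + 1) := by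
  have h1 : (0 : ℝ) < n (d + 1) := by exact_mod_cast hn (d + 1) (Nat.le_add_left _ _) hd
  have h2 : (0 : ℝ) ≤ ∑ i2 : Idx n (d + 1),
        if resIdx n (Nat.le_succ d) i2 = i
        then ((plusSum n D X D' hd i2 : ℕ) : ℝ) else 0 :=
    Finset.sum_nonneg fun k _ => by split_ifs <;> positivity
  have := mul_pos h1 (ha (d + 1))
  linarith

lemma splitRatio_pos (hn : ∀ d, 1 ≤ d → d ≤ D → 1 ≤ n d) (ha : ∀ d, 0 < a d) (D' : ℕ)
    (X : Obs n D) {d : ℕ} (hd : d + 1 ≤ D) (i : Idx n (d + 1)) :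
    0 < splitRatio n D a D' X hd i :=
  div_pos (by have := ha (d + 1); positivity) (splitRatio_denom_pos hn ha D' X hd _)

lemma levelBayes_pos (hn : ∀ d, 1 ≤ d → d ≤ D → 1 ≤ n d) (ha : ∀ d, 0 < a d) {D' : ℕ}
    (hD' : D' ≤ D) (X : Obs n D) {e : ℕ} (he : e ≤ D) (i : Idx n e) :
    0 < levelBayes n D a D' X he i := by
  have h0 := ha 0
  have h1 : (D' : ℝ) ≤ D := by exact_mod_cast hD'
  refine mul_pos (div_pos (by positivity) (by linarith)) ?_
  exact Finset.prod_pos fun d _ => splitRatio_pos hn ha D' X _ _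

lemma sum_levelBayes_children (hn : ∀ d, 1 ≤ d → d ≤ D → 1 ≤ n d) (ha : ∀ d, 0 < a d) (D' : ℕ)
    (X : Obs n D) {e : ℕ} (he : e + 1 ≤ D) (i : Idx n e) :
    ∑ j : Idx n (e + 1),
      (if resIdx n (Nat.le_succ e) j = i then levelBayes n D a D' X he j else 0) =
    levelBayes n D a D' X (Nat.le_of_succ_le he) i := by
  have hden := splitRatio_denom_pos hn ha D' X he i
  have hterm : ∀ j : Idx n (e + 1),
      (if resIdx n (Nat.le_succ e) j = i then levelBayes n D a D' X he j else 0) =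
      levelBayes n D a D' X (Nat.le_of_succ_le he) i *
        (((if resIdx n (Nat.le_succ e) j = i then ((plusSum n D X D' he j : ℕ) : ℝ) else 0) +
          (if resIdx n (Nat.le_succ e) j = i then a (e + 1) else 0)) /
        ((∑ i2 : Idx n (e + 1),
        if resIdx n (Nat.le_succ e) i2 = i
        then ((plusSum n D X D' he i2 : ℕ) : ℝ) else 0) + (n (e + 1) : ℝ) * a (e + 1))) := by
    intro j
    by_cases h : resIdx n (Nat.le_succ e) j = i
    · subst h
      simp only [if_true]
      rw [levelBayes_succ, splitRatio]
    · simp [h]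
  rw [Finset.sum_congr rfl fun j _ => hterm j, ← Finset.mul_sum, ← Finset.sum_div,
    Finset.sum_add_distrib, sum_ite_resIdx_const, div_self hden.ne', mul_one]

lemma marg_hierBayes (hn : ∀ d, 1 ≤ d → d ≤ D → 1 ≤ n d) (ha : ∀ d, 0 < a d) (D' : ℕ)
    (X : Obs n D) {e : ℕ} (he : e ≤ D) (i : Idx n e) :
    marg n D (hierBayes n D a D' X) he i = levelBayes n D a D' X he i := by
  induction he using Nat.decreasingInduction with
  | self => rw [marg_self, hierBayes_eq_levelBayes]
  | of_succ e he ih =>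
    rw [marg_eq_sum_marg _ (Nat.le_succ e) he, ← sum_levelBayes_children hn ha D' X he]
    exact Finset.sum_congr rfl fun j _ => by rw [ih]

lemma plusSum_eq_of_le (X : Obs n D) {D₁ D₂ d : ℕ} (h1 : D₁ ≤ d) (h2 : D₂ ≤ d) (hd : d ≤ D)
    (i : Idx n d) : plusSum n D X D₁ hd i = plusSum n D X D₂ hd i := by
  refine Finset.sum_congr rfl fun d' _ => ?_
  split_ifs with h
  · simp [h1.trans h, h2.trans h]
  · rfl

lemma plusSum_eq_sum_children (X : Obs n D) {D' d : ℕ} (h : d < D') (hd : d + 1 ≤ D)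
    (i : Idx n d) :
    plusSum n D X D' (Nat.le_of_succ_le hd) i =
      ∑ j : Idx n (d + 1),
        if resIdx n (Nat.le_succ d) j = i then plusSum n D X D' hd j else 0 := by
  simp only [plusSum]
  have hpush : ∀ j : Idx n (d + 1), ∀ F : Fin (D + 1) → ℕ,
      (if resIdx n (Nat.le_succ d) j = i then ∑ d', F d' else 0) =
        ∑ d', if resIdx n (Nat.le_succ d) j = i then F d' else 0 := fun j F => by
    split_ifs <;> simp
  simp_rw [hpush]
  rw [Finset.sum_comm]
  refine Finset.sum_congr rfl fun d' _ => ?_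
  by_cases hd' : D' ≤ d'.val
  · have h1 : d + 1 ≤ d'.val := h.trans_le hd'
    simp only [h1, Nat.le_of_succ_le h1, hd', and_true, dite_true]
    exact (sum_ite_resIdx_sum_ite_resIdx (Nat.le_succ d) h1 (X d') i).symm
  · simp [hd']

lemma levelBayes_eq_of_le (hn : ∀ d, 1 ≤ d → d ≤ D → 1 ≤ n d) (ha : ∀ d, 0 < a d)
    (haJ : ∀ d, d < D → (n (d + 1) : ℝ) * a (d + 1) = a d) {D' : ℕ} (X : Obs n D) {e : ℕ}
    (he' : e ≤ D') (he : e ≤ D) (i : Idx n e) :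
    levelBayes n D a D' X he i = (((plusSum n D X D' he i : ℕ) : ℝ) + a e) /
      (1 + (D : ℝ) - (D' : ℝ)) := by
  induction e with
  | zero =>
    have : i = fun k => k.elim0 := funext fun k => k.elim0
    subst this
    simp [levelBayes]
  | succ e ih =>
    have hden := splitRatio_denom_pos hn ha D' X he (resIdx n (Nat.le_succ e) i)
    rw [levelBayes_succ, ih (Nat.le_of_succ_le he'), splitRatio]
    have h1 := plusSum_eq_sum_children X he' he (resIdx n (Nat.le_succ e) i)
    have h2 : ((plusSum n D X D' (Nat.le_of_succ_le he) (resIdx n (Nat.le_succ e) i) : ℕ) : ℝ)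
        = ∑ j : Idx n (e + 1), if resIdx n (Nat.le_succ e) j = resIdx n (Nat.le_succ e) i
          then ((plusSum n D X D' he j : ℕ) : ℝ) else 0 := by
      rw [h1]; push_cast; rfl
    rw [← h2, haJ e he] at hden ⊢
    field_simp

/-- Above the levels where they differ, the two estimators differ by a common factor. -/
lemma log_levelBayes_succ_sub (hn : ∀ d, 1 ≤ d → d ≤ D → 1 ≤ n d) (ha : ∀ d, 0 < a d)
    {D₁ D₂ : ℕ} (hD₁ : D₁ ≤ D) (hD₂ : D₂ ≤ D) (X : Obs n D) {e : ℕ} (h1 : D₁ ≤ e + 1)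
    (h2 : D₂ ≤ e + 1) (he : e + 1 ≤ D) (i : Idx n (e + 1)) :
    Real.log (levelBayes n D a D₁ X he i) - Real.log (levelBayes n D a D₂ X he i) =
      Real.log (levelBayes n D a D₁ X (Nat.le_of_succ_le he) (resIdx n (Nat.le_succ e) i)) -
      Real.log (levelBayes n D a D₂ X (Nat.le_of_succ_le he) (resIdx n (Nat.le_succ e) i)) := by
  have hs : splitRatio n D a D₁ X he i = splitRatio n D a D₂ X he i := by
    simp only [splitRatio, plusSum_eq_of_le X h1 h2 he]
  rw [levelBayes_succ, levelBayes_succ, hs,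
    Real.log_mul (levelBayes_pos hn ha hD₁ X _ _).ne' (splitRatio_pos hn ha _ X he i).ne',
    Real.log_mul (levelBayes_pos hn ha hD₂ X _ _).ne' (splitRatio_pos hn ha _ X he i).ne']
  ring

/-- The entropy loss of the estimator based on the levels `≥ D'`, at level `e` only. -/
noncomputable def levelLoss (n : ℕ → ℕ) (D : ℕ) (a : ℕ → ℝ) (lam : Idx n D → ℝ) (D' : ℕ)
    {e : ℕ} (he : e ≤ D) (X : Obs n D) : ℝ :=
  ∑ i : Idx n e, entropyLoss (marg n D lam he i) (levelBayes n D a D' X he i)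

lemma hierLoss_hierBayes (hn : ∀ d, 1 ≤ d → d ≤ D → 1 ≤ n d) (ha : ∀ d, 0 < a d)
    (lam : Idx n D → ℝ) (D' : ℕ) (X : Obs n D) :
    hierLoss n D (hierBayes n D a D' X) lam =
      ∑ d : Fin (D + 1), levelLoss n D a lam D' (Nat.lt_succ_iff.mp d.isLt) X := by
  simp only [hierLoss, marg_hierBayes hn ha, levelLoss, entropyLoss]

lemma levelLoss_succ_sub (hn : ∀ d, 1 ≤ d → d ≤ D → 1 ≤ n d) (ha : ∀ d, 0 < a d)
    {lam : Idx n D → ℝ} (hlam : ∀ j, 0 < lam j)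
    {D₁ D₂ : ℕ} (hD₁ : D₁ ≤ D) (hD₂ : D₂ ≤ D) (X : Obs n D) {e : ℕ} (h1 : D₁ ≤ e + 1)
    (h2 : D₂ ≤ e + 1) (he : e + 1 ≤ D) :
    levelLoss n D a lam D₁ he X - levelLoss n D a lam D₂ he X =
      levelLoss n D a lam D₁ (Nat.le_of_succ_le he) X -
        levelLoss n D a lam D₂ (Nat.le_of_succ_le he) X := by
  have hdiff : ∀ {e : ℕ} (he : e ≤ D) (i : Idx n e),
      entropyLoss (marg n D lam he i) (levelBayes n D a D₁ X he i) -
        entropyLoss (marg n D lam he i) (levelBayes n D a D₂ X he i) =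
      levelBayes n D a D₁ X he i - levelBayes n D a D₂ X he i - marg n D lam he i *
        (Real.log (levelBayes n D a D₁ X he i) - Real.log (levelBayes n D a D₂ X he i)) := by
    intro e he i
    rw [entropyLoss_eq (marg_pos hn hlam he i) (levelBayes_pos hn ha hD₁ X he i),
      entropyLoss_eq (marg_pos hn hlam he i) (levelBayes_pos hn ha hD₂ X he i)]
    ring
  simp only [levelLoss, ← Finset.sum_sub_distrib, hdiff]
  simp only [log_levelBayes_succ_sub hn ha hD₁ hD₂ X h1 h2 he]
  rw [← sum_sum_ite_resIdx (Nat.le_succ e)]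
  refine Finset.sum_congr rfl fun i _ => ?_
  rw [← sum_levelBayes_children hn ha D₁ X he i, ← sum_levelBayes_children hn ha D₂ X he i,
    marg_eq_sum_marg lam (Nat.le_succ e) he i, ← Finset.sum_sub_distrib, Finset.sum_mul,
    ← Finset.sum_sub_distrib]
  refine Finset.sum_congr rfl fun j _ => ?_
  split_ifs with h
  · subst h
    rw [sum_levelBayes_children hn ha D₁ X he, sum_levelBayes_children hn ha D₂ X he]
  · simp

end Hierarchy

section HierarchicalMeasure

variable {n : ℕ → ℕ} {D : ℕ}

/-- The law of the hierarchical Poisson observations. -/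
noncomputable def hierMeasure (n : ℕ → ℕ) (D : ℕ) (lam : Idx n D → ℝ) : Measure (Obs n D) :=
  Measure.pi fun d : Fin (D + 1) => Measure.pi fun i : Idx n d.val =>
    poissonMeasure (marg n D lam (Nat.lt_succ_iff.mp d.isLt) i).toNNReal

instance (lam : Idx n D → ℝ) : IsProbabilityMeasure (hierMeasure n D lam) := by
  unfold hierMeasure; infer_instance

lemma hierMeasure_singleton {lam : Idx n D → ℝ}
    (hlam : ∀ (d : ℕ) (h : d ≤ D) (i : Idx n d), 0 < marg n D lam h i) (X : Obs n D) :
    hierMeasure n D lam {X} = ENNReal.ofReal (hierPmf n D lam X) := by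
  have hpos : ∀ (d : Fin (D + 1)) (i : Idx n d.val),
      0 ≤ poissonPmf (marg n D lam (Nat.lt_succ_iff.mp d.isLt) i) (X d i) := fun d i => by
    have := hlam d (Nat.lt_succ_iff.mp d.isLt) i
    unfold poissonPmf; positivity
  rw [hierMeasure, Measure.pi_singleton, hierPmf,
    ENNReal.ofReal_prod_of_nonneg fun d _ => Finset.prod_nonneg fun i _ => hpos d i]
  refine Finset.prod_congr rfl fun d _ => ?_
  rw [Measure.pi_singleton, ENNReal.ofReal_prod_of_nonneg fun i _ => hpos d i]
  refine Finset.prod_congr rfl fun i _ => ?_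
  rw [poissonMeasure_singleton, Real.coe_toNNReal _ (hlam d _ i).le, poissonPmf,
    mul_comm (Real.exp _)]

lemma hierRisk_eq_lintegral {lam : Idx n D → ℝ}
    (hlam : ∀ (d : ℕ) (h : d ≤ D) (i : Idx n d), 0 < marg n D lam h i)
    (δ : Obs n D → Idx n D → ℝ) (hδ : ∀ X, 0 ≤ hierLoss n D (δ X) lam) :
    hierRisk n D δ lam = ∫⁻ X, ENNReal.ofReal (hierLoss n D (δ X) lam) ∂(hierMeasure n D lam) := by
  rw [lintegral_countable', hierRisk]
  exact tsum_congr fun X => by rw [hierMeasure_singleton hlam, ENNReal.ofReal_mul (hδ X)]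

lemma hasLaw_obs (lam : Idx n D → ℝ) (c : Σ d : Fin (D + 1), Idx n d.val) :
    HasLaw (fun X : Obs n D => X c.1 c.2)
      (poissonMeasure (marg n D lam (Nat.lt_succ_iff.mp c.1.isLt) c.2).toNNReal)
      (hierMeasure n D lam) := by
  have h1 := measurePreserving_eval (fun d : Fin (D + 1) => Measure.pi fun i : Idx n d.val =>
    poissonMeasure (marg n D lam (Nat.lt_succ_iff.mp d.isLt) i).toNNReal) c.1
  have h2 := measurePreserving_eval (fun i : Idx n c.1.val =>
    poissonMeasure (marg n D lam (Nat.lt_succ_iff.mp c.1.isLt) i).toNNReal) c.2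
  have h3 := h2.comp h1
  exact ⟨h3.measurable.aemeasurable, h3.map_eq⟩

lemma iIndepFun_hierMeasure (lam : Idx n D → ℝ) :
    iIndepFun (fun (c : Σ d : Fin (D + 1), Idx n d.val) (X : Obs n D) => X c.1 c.2)
      (hierMeasure n D lam) := by
  refine iIndepFun_uncurry (X := fun (d : Fin (D + 1)) (i : Idx n d.val) (X : Obs n D) => X d i)
    (fun _ _ => .of_discrete) ?_ fun d => ?_
  · exact iIndepFun_pi (X := fun (d : Fin (D + 1)) (x : Idx n d.val → ℕ) => x)
      fun _ => aemeasurable_id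
  · rw [iIndepFun_iff_map_fun_eq_pi_map fun _ => .of_discrete]
    have h := measurePreserving_eval (fun d : Fin (D + 1) => Measure.pi fun i : Idx n d.val =>
      poissonMeasure (marg n D lam (Nat.lt_succ_iff.mp d.isLt) i).toNNReal) d
    exact h.map_eq.trans (congrArg Measure.pi (funext fun i => (hasLaw_obs lam ⟨d, i⟩).map_eq.symm))

lemma poissonMeasure_zero : poissonMeasure 0 = Measure.dirac 0 := by
  refine Measure.ext_of_singleton fun k => ?_
  rw [poissonMeasure_singleton]
  cases k <;> simp

lemma hasLaw_finsetSum_poissonMeasure {ι Ω : Type*} {mΩ : MeasurableSpace Ω} {P : Measure Ω}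
    [IsProbabilityMeasure P] {X : ι → Ω → ℕ} {r : ι → NNReal} (hind : iIndepFun X P)
    (hm : ∀ i, Measurable (X i)) (hlaw : ∀ i, HasLaw (X i) (poissonMeasure (r i)) P)
    (s : Finset ι) : HasLaw (∑ i ∈ s, X i) (poissonMeasure (∑ i ∈ s, r i)) P := by
  classical
  induction s using Finset.induction_on with
  | empty =>
    refine ⟨aemeasurable_const, ?_⟩
    rw [Finset.sum_empty, Finset.sum_empty, poissonMeasure_zero]
    exact (Measure.map_const P (0 : ℕ)).trans (by simp)
  | insert i s hi ih =>
    rw [Finset.sum_insert hi, Finset.sum_insert hi, add_comm, add_comm (r i)]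
    exact (hind.indepFun_finsetSum_of_notMem hm hi).hasLaw_add_poissonMeasure ih (hlaw i)

lemma hasLaw_plusSum {lam : Idx n D → ℝ}
    (hlam : ∀ (d : ℕ) (h : d ≤ D) (i : Idx n d), 0 < marg n D lam h i) {D' d : ℕ}
    (hd : d ≤ D') (hD' : D' ≤ D) (i : Idx n d) :
    HasLaw (fun X : Obs n D => plusSum n D X D' (hd.trans hD') i)
      (poissonMeasure ((1 + (D : ℝ) - D') * marg n D lam (hd.trans hD') i).toNNReal)
      (hierMeasure n D lam) := by
  classical
  let A : Finset (Σ d : Fin (D + 1), Idx n d.val) := Finset.univ.filter fun c =>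
    ∃ h : d ≤ c.1.val, resIdx n h c.2 = i ∧ D' ≤ c.1.val
  have hA : ∀ {M : Type} [AddCommMonoid M] (F : (d : Fin (D + 1)) → Idx n d.val → M),
      ∑ c ∈ A, F c.1 c.2 = ∑ d' : Fin (D + 1), if h : d ≤ d'.val then
        ∑ j : Idx n d'.val, if resIdx n h j = i ∧ D' ≤ d'.val then F d' j else 0 else 0 := by
    intro M _ F
    rw [Finset.sum_filter, Fintype.sum_sigma]
    refine Finset.sum_congr rfl fun d' _ => ?_
    split_ifs with h
    · simp [h]
    · simp [h]
  have hlaw := hasLaw_finsetSum_poissonMeasure (iIndepFun_hierMeasure lam)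
    (fun _ => .of_discrete) (hasLaw_obs lam) A
  have hsum : (∑ c ∈ A, fun X : Obs n D => X c.1 c.2) =
      fun X : Obs n D => plusSum n D X D' (hd.trans hD') i := by
    funext X
    rw [Finset.sum_apply]
    exact hA X
  have hrate : ∑ c ∈ A, (marg n D lam (Nat.lt_succ_iff.mp c.1.isLt) c.2).toNNReal =
      ((1 + (D : ℝ) - D') * marg n D lam (hd.trans hD') i).toNNReal := by
    rw [← Real.toNNReal_sum_of_nonneg fun c _ => (hlam _ _ c.2).le,
      hA fun d' j => marg n D lam (Nat.lt_succ_iff.mp d'.isLt) j]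
    congr 1
    have hterm : ∀ d' : Fin (D + 1), (if h : d ≤ d'.val then
        ∑ j : Idx n d'.val, if resIdx n h j = i ∧ D' ≤ d'.val then
          marg n D lam (Nat.lt_succ_iff.mp d'.isLt) j else 0 else 0) =
        if D' ≤ d'.val then marg n D lam (hd.trans hD') i else 0 := by
      intro d'
      by_cases h : D' ≤ d'.val
      · simp only [h, hd.trans h, and_true, dite_true, if_true]
        exact (marg_eq_sum_marg lam (hd.trans h) (Nat.lt_succ_iff.mp d'.isLt) i).symm
      · simp [h]
    rw [Finset.sum_congr rfl fun d' _ => hterm d', ← Finset.sum_filter, Finset.sum_const,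
      nsmul_eq_mul]
    have hcard : (Finset.univ.filter fun d' : Fin (D + 1) => D' ≤ d'.val) =
        Finset.Ici ⟨D', Nat.lt_succ_of_le hD'⟩ := by
      ext d'
      simp [Fin.le_def]
    rw [hcard, Fin.card_Ici, Nat.cast_sub (Nat.le_succ_of_le hD')]
    push_cast
    ring
  rw [hsum, hrate] at hlaw
  exact hlaw

variable {a : ℕ → ℝ}

lemma entropyLoss_levelBayes_integral (hn : ∀ d, 1 ≤ d → d ≤ D → 1 ≤ n d) (ha : ∀ d, 0 < a d)
    (haJ : ∀ d, d < D → (n (d + 1) : ℝ) * a (d + 1) = a d) {lam : Idx n D → ℝ}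
    (hlam : ∀ j, 0 < lam j) {D' e : ℕ} (he : e ≤ D') (hD' : D' ≤ D) (i : Idx n e) :
    Integrable (fun X => entropyLoss (marg n D lam (he.trans hD') i)
      (levelBayes n D a D' X (he.trans hD') i)) (hierMeasure n D lam) ∧
    ∫ X, entropyLoss (marg n D lam (he.trans hD') i)
      (levelBayes n D a D' X (he.trans hD') i) ∂(hierMeasure n D lam) =
    gammaBayesRisk (marg n D lam (he.trans hD') i) (a e) (1 + D - D') +
      marg n D lam (he.trans hD') i * Real.log (marg n D lam (he.trans hD') i) := by
  have hm := marg_pos hn hlam (he.trans hD') i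
  have ht : 0 < 1 + (D : ℝ) - D' := by
    have : (D' : ℝ) ≤ D := by exact_mod_cast hD'
    linarith
  have hlaw := hasLaw_plusSum (fun d h i => marg_pos hn hlam h i) he hD' i
  simp only [levelBayes_eq_of_le hn ha haJ _ he]
  have hint := integrable_entropyLoss_poissonMeasure hm (ha e) ht
    ((1 + (D : ℝ) - D') * marg n D lam (he.trans hD') i).toNNReal
  refine ⟨?_, ?_⟩
  · rw [← hlaw.map_eq] at hint
    exact hint.comp_aemeasurable hlaw.aemeasurable
  · rw [← integral_entropyLoss_poissonMeasure hm (ha e) ht]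
    exact hlaw.integral_comp hint.aestronglyMeasurable

lemma integrable_levelLoss (hn : ∀ d, 1 ≤ d → d ≤ D → 1 ≤ n d) (ha : ∀ d, 0 < a d)
    (haJ : ∀ d, d < D → (n (d + 1) : ℝ) * a (d + 1) = a d) {lam : Idx n D → ℝ}
    (hlam : ∀ j, 0 < lam j) {D' e : ℕ} (he : e ≤ D') (hD' : D' ≤ D) :
    Integrable (levelLoss n D a lam D' (he.trans hD')) (hierMeasure n D lam) :=
  integrable_finsetSum _ fun i _ =>
    (entropyLoss_levelBayes_integral hn ha haJ hlam he hD' i).1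

lemma levelLoss_sub_integral_neg (hn : ∀ d, 1 ≤ d → d ≤ D → 1 ≤ n d) (ha : ∀ d, 0 < a d)
    (haJ : ∀ d, d < D → (n (d + 1) : ℝ) * a (d + 1) = a d) (ha1 : ∀ d, d < D → 1 ≤ a d)
    {lam : Idx n D → ℝ} (hlam : ∀ j, 0 < lam j) {k : ℕ} (hk : k + 1 ≤ D) {e : ℕ} (he : e ≤ D) :
    Integrable (fun X => levelLoss n D a lam k he X - levelLoss n D a lam (k + 1) he X)
      (hierMeasure n D lam) ∧
    ∫ X, (levelLoss n D a lam k he X - levelLoss n D a lam (k + 1) he X)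
      ∂(hierMeasure n D lam) < 0 := by
  have hlow : ∀ {e : ℕ} (hek : e ≤ k) (he : e ≤ D),
      Integrable (fun X => levelLoss n D a lam k he X - levelLoss n D a lam (k + 1) he X)
        (hierMeasure n D lam) ∧
      ∫ X, (levelLoss n D a lam k he X - levelLoss n D a lam (k + 1) he X)
        ∂(hierMeasure n D lam) < 0 := by
    intro e hek he
    have i1 := integrable_levelLoss hn ha haJ hlam hek (Nat.le_of_succ_le hk)
    have i2 := integrable_levelLoss hn ha haJ hlam (Nat.le_succ_of_le hek) hk
    refine ⟨i1.sub i2, ?_⟩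
    rw [integral_sub i1 i2]
    simp only [levelLoss]
    have j1 := fun i => entropyLoss_levelBayes_integral hn ha haJ hlam hek (Nat.le_of_succ_le hk) i
    have j2 := fun i => entropyLoss_levelBayes_integral hn ha haJ hlam (Nat.le_succ_of_le hek) hk i
    rw [integral_finsetSum _ fun i _ => (j1 i).1, integral_finsetSum _ fun i _ => (j2 i).1,
      sub_neg]
    obtain ⟨i₀⟩ : Nonempty (Idx n e) :=
      ⟨fun k => ⟨0, hn _ (Nat.le_add_left _ _) (Nat.le_trans k.isLt he)⟩⟩
    refine Finset.sum_lt_sum_of_nonempty ⟨i₀, Finset.mem_univ _⟩ fun i _ => ?_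
    rw [(j1 i).2, (j2 i).2]
    have hkD : (k : ℝ) + 1 ≤ D := by exact_mod_cast hk
    have h1 : 1 + (D : ℝ) - (k + 1 : ℕ) ∈ Set.Ioi 0 := by
      rw [Set.mem_Ioi]; push_cast; linarith
    have h2 : 1 + (D : ℝ) - k ∈ Set.Ioi 0 := by
      rw [Set.mem_Ioi]; linarith
    have h3 := gammaBayesRisk_strictAntiOn (marg_pos hn hlam he i)
      (ha1 e (lt_of_le_of_lt hek hk)) h1 h2 (by push_cast; linarith)
    exact add_lt_add_left h3 _
  induction e with
  | zero => exact hlow (Nat.zero_le k) he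
  | succ e ih =>
    by_cases hek : e + 1 ≤ k
    · exact hlow hek he
    · have h1 : k + 1 ≤ e + 1 := by omega
      simp only [levelLoss_succ_sub hn ha hlam (Nat.le_of_succ_le hk) hk _
        (Nat.le_of_succ_le h1) h1 he]
      exact ih (Nat.le_of_succ_le he)

lemma integrable_hierLoss (hn : ∀ d, 1 ≤ d → d ≤ D → 1 ≤ n d) (ha : ∀ d, 0 < a d)
    (haJ : ∀ d, d < D → (n (d + 1) : ℝ) * a (d + 1) = a d) (ha1 : ∀ d, d < D → 1 ≤ a d)
    {lam : Idx n D → ℝ} (hlam : ∀ j, 0 < lam j) {k : ℕ} (hk : k ≤ D) :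
    Integrable (fun X => hierLoss n D (hierBayes n D a k X) lam) (hierMeasure n D lam) := by
  induction hk using Nat.decreasingInduction with
  | self =>
    simp only [hierLoss_hierBayes hn ha]
    exact integrable_finsetSum _ fun d _ =>
      integrable_levelLoss hn ha haJ hlam (Nat.lt_succ_iff.mp d.isLt) le_rfl
  | of_succ k hk ih =>
    have hdiff := integrable_finsetSum Finset.univ fun (d : Fin (D + 1)) _ =>
      (levelLoss_sub_integral_neg hn ha haJ ha1 hlam hk (Nat.lt_succ_iff.mp d.isLt)).1
    refine (ih.add hdiff).congr (ae_of_all _ fun X => ?_)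
    simp only [Pi.add_apply, hierLoss_hierBayes hn ha, Finset.sum_sub_distrib]
    ring

lemma hierRisk_hierBayes_lt (hn : ∀ d, 1 ≤ d → d ≤ D → 1 ≤ n d) (ha : ∀ d, 0 < a d)
    (haJ : ∀ d, d < D → (n (d + 1) : ℝ) * a (d + 1) = a d) (ha1 : ∀ d, d < D → 1 ≤ a d)
    {lam : Idx n D → ℝ} (hlam : ∀ j, 0 < lam j) {k : ℕ} (hk : k + 1 ≤ D) :
    hierRisk n D (hierBayes n D a k) lam < hierRisk n D (hierBayes n D a (k + 1)) lam := by
  have hpos : ∀ (d : ℕ) (h : d ≤ D) (i : Idx n d), 0 < marg n D lam h i :=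
    fun d h i => marg_pos hn hlam h i
  have hnonneg : ∀ {k : ℕ}, k ≤ D → ∀ X, 0 ≤ hierLoss n D (hierBayes n D a k X) lam := by
    intro k hk X
    rw [hierLoss_hierBayes hn ha]
    exact Finset.sum_nonneg fun d _ => Finset.sum_nonneg fun i _ =>
      entropyLoss_nonneg (hpos _ _ i) (levelBayes_pos hn ha hk X _ i)
  have hk' := Nat.le_of_succ_le hk
  have i1 := integrable_hierLoss hn ha haJ ha1 hlam hk'
  have i2 := integrable_hierLoss hn ha haJ ha1 hlam hk
  rw [hierRisk_eq_lintegral hpos _ (hnonneg hk'), hierRisk_eq_lintegral hpos _ (hnonneg hk),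
    ← ofReal_integral_eq_lintegral_ofReal i1 (ae_of_all _ (hnonneg hk')),
    ← ofReal_integral_eq_lintegral_ofReal i2 (ae_of_all _ (hnonneg hk))]
  have hlt : ∫ X, hierLoss n D (hierBayes n D a k X) lam ∂(hierMeasure n D lam) <
      ∫ X, hierLoss n D (hierBayes n D a (k + 1) X) lam ∂(hierMeasure n D lam) := by
    rw [← sub_neg, ← integral_sub i1 i2]
    simp only [hierLoss_hierBayes hn ha, ← Finset.sum_sub_distrib]
    have hd := fun d : Fin (D + 1) =>
      levelLoss_sub_integral_neg hn ha haJ ha1 hlam hk (Nat.lt_succ_iff.mp d.isLt)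
    rw [integral_finsetSum _ fun d _ => (hd d).1]
    exact Finset.sum_neg (fun d _ => (hd d).2) Finset.univ_nonempty
  exact (ENNReal.ofReal_lt_ofReal_iff_of_nonneg (integral_nonneg (hnonneg hk'))).mpr hlt

end HierarchicalMeasure

/- STATEMENT 16: with Jeffreys exponents a^J_d = (1/2)·Π_{d'=d+1}^D n_{d'} and n_D ≥ 2,
for every D' ∈ {1,…,D} the estimator based on levels ≥ D' is strictly dominated by the
one based on levels ≥ D'−1; in particular λ̂^{(a^J)}(X(D)) is dominated by λ̂^{(a^J)}(X(0)). -/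
theorem stmt_16 (D : ℕ) (hD : 1 ≤ D) (n : ℕ → ℕ)
    (hn : ∀ d, 1 ≤ d → d ≤ D → 1 ≤ n d) (hnD : 2 ≤ n D)
    (aJ : ℕ → ℝ) (haJ : ∀ d, aJ d = (∏ d' ∈ Finset.Icc (d + 1) D, (n d' : ℝ)) / 2)
    (lam : Idx n D → ℝ) (hlam : ∀ j, 0 < lam j) :
    ∀ D', 1 ≤ D' → D' ≤ D →
      hierRisk n D (hierBayes n D aJ (D' - 1)) lam <
        hierRisk n D (hierBayes n D aJ D') lam := by
  have haJ' : ∀ d, d < D → (n (d + 1) : ℝ) * aJ (d + 1) = aJ d := fun d hd => by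
    rw [haJ, haJ, ← Finset.insert_Icc_add_one_left_eq_Icc (Nat.succ_le_of_lt hd),
      Finset.prod_insert (by simp)]
    ring
  have hprod : ∀ d, 0 < ∏ d' ∈ Finset.Icc (d + 1) D, n d' := fun d =>
    Finset.prod_pos fun d' hd' => by
      rw [Finset.mem_Icc] at hd'
      exact hn d' (by omega) hd'.2
  have ha : ∀ d, 0 < aJ d := fun d => by
    rw [haJ]
    have : (0 : ℝ) < ∏ d' ∈ Finset.Icc (d + 1) D, (n d' : ℝ) := by exact_mod_cast hprod d
    positivity
  have ha1 : ∀ d, d < D → 1 ≤ aJ d := fun d hd => by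
    have h : n D ≤ ∏ d' ∈ Finset.Icc (d + 1) D, n d' :=
      Nat.le_of_dvd (hprod d) (Finset.dvd_prod_of_mem _ (Finset.mem_Icc.mpr ⟨hd, le_rfl⟩))
    have h2 : (2 : ℝ) ≤ ∏ d' ∈ Finset.Icc (d + 1) D, (n d' : ℝ) := by exact_mod_cast hnD.trans h
    rw [haJ]
    linarith
  intro D' h1 h2
  obtain ⟨k, rfl⟩ := Nat.exists_eq_add_of_le' h1
  exact hierRisk_hierBayes_lt hn ha haJ' ha1 hlam h2
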